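/- Let G be a graph on n vertices with maximum degree Δ(G) ≤ Δ and maximum codegree Δ₂(G) ≤ 2^{-7} Δ (log Δ)^{-7}. Then the independence number satisfies α(G) ≥ (1 - o(1)) · n log Δ / Δ, where o(1) → 0 as Δ → ∞. More precisely, for every ε ∈ (0, 1/2) there exists Δ₀ = Δ₀(ε) such that for all Δ ≥ Δ₀, every such graph satisfies α(G) ≥ (1 - ε) n log Δ / Δ. -/

import Mathlib

open Finset in
/-- The weight of `B` under the distribution including each element independently with
probability `p`. -/
noncomputable def bernoulliWeight {W : Type*} [Fintype W] (p : ℝ) (B : Finset W) : ℝ :=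
  p ^ #B * (1 - p) ^ (Fintype.card W - #B)

open Classical in
/-- The probability that a `p`-random subset of `W` satisfies `P`. -/
noncomputable def randomSubsetProb {W : Type*} [Fintype W] (p : ℝ) (P : Finset W → Prop) : ℝ :=
  ∑ B : Finset W, if P B then bernoulliWeight p B else 0

section RandomSubset

variable {W : Type*} [Fintype W] {p : ℝ}

open Finset

lemma bernoulliWeight_nonneg (h0 : 0 ≤ p) (h1 : p ≤ 1) (B : Finset W) :
    0 ≤ bernoulliWeight p B :=
  mul_nonneg (pow_nonneg h0 _) (pow_nonneg (by linarith) _)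

lemma randomSubsetProb_disjoint (p : ℝ) (M : Finset W) :
    randomSubsetProb p (fun B => Disjoint B M) = (1 - p) ^ #M := by
  classical
  have hf : (univ.filter fun B : Finset W => Disjoint B M) = (Mᶜ).powerset := by
    ext B
    simp [Finset.mem_powerset, Finset.subset_compl_iff_disjoint_right]
  have key := Finset.sum_pow_mul_eq_add_pow p (1 - p) Mᶜ
  rw [add_sub_cancel, one_pow] at key
  have hW : Fintype.card W = #M + #Mᶜ := by simp
  calc randomSubsetProb p (fun B => Disjoint B M)
      = ∑ B ∈ (Mᶜ).powerset, bernoulliWeight p B := by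
        rw [← hf, Finset.sum_filter]
        unfold randomSubsetProb
        exact Finset.sum_congr rfl fun B _ => by congr
    _ = ∑ B ∈ (Mᶜ).powerset, (1 - p) ^ #M * (p ^ #B * (1 - p) ^ (#Mᶜ - #B)) := by
        refine Finset.sum_congr rfl fun B hB => ?_
        have hc := Finset.card_le_card (Finset.mem_powerset.1 hB)
        have : Fintype.card W - #B = #M + (#Mᶜ - #B) := by omega
        rw [bernoulliWeight, this, pow_add]
        ring
    _ = (1 - p) ^ #M := by rw [← Finset.mul_sum, key, mul_one]

lemma sum_bernoulliWeight (p : ℝ) : ∑ B : Finset W, bernoulliWeight p B = 1 := by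
  simpa [randomSubsetProb] using randomSubsetProb_disjoint p (∅ : Finset W)

lemma randomSubsetProb_or_le (h0 : 0 ≤ p) (h1 : p ≤ 1) (P Q : Finset W → Prop) :
    randomSubsetProb p (fun B => P B ∨ Q B) ≤ randomSubsetProb p P + randomSubsetProb p Q := by
  unfold randomSubsetProb
  rw [← Finset.sum_add_distrib]
  refine Finset.sum_le_sum fun B _ => ?_
  have := bernoulliWeight_nonneg h0 h1 B
  by_cases hP : P B <;> by_cases hQ : Q B <;> simp [hP, hQ, this]

lemma randomSubsetProb_exists_le (h0 : 0 ≤ p) (h1 : p ≤ 1) {ι : Type*} (T : Finset ι)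
    (P : ι → Finset W → Prop) :
    randomSubsetProb p (fun B => ∃ i ∈ T, P i B) ≤ ∑ i ∈ T, randomSubsetProb p (P i) := by
  classical
  induction T using Finset.induction_on with
  | empty => simp [randomSubsetProb]
  | insert a T ha ih =>
    rw [Finset.sum_insert ha]
    simp only [Finset.exists_mem_insert]
    exact (randomSubsetProb_or_le h0 h1 _ _).trans (by gcongr)

lemma randomSubsetProb_mem_and_disjoint (p : ℝ) {x : W} {M : Finset W} (hx : x ∉ M) :
    randomSubsetProb p (fun B => x ∈ B ∧ Disjoint B M) = p * (1 - p) ^ #M := by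
  classical
  have h : randomSubsetProb p (fun B => x ∈ B ∧ Disjoint B M) =
      randomSubsetProb p (fun B => Disjoint B M) -
        randomSubsetProb p (fun B => Disjoint B (insert x M)) := by
    unfold randomSubsetProb
    rw [← Finset.sum_sub_distrib]
    refine Finset.sum_congr rfl fun B _ => ?_
    by_cases hB : x ∈ B <;> by_cases hD : Disjoint B M <;>
      simp [hB, hD, Finset.disjoint_insert_right]
  rw [h, randomSubsetProb_disjoint, randomSubsetProb_disjoint, Finset.card_insert_of_notMem hx]
  ring

lemma sum_bernoulliWeight_mul_card_filter (p : ℝ) {ι : Type*} (T : Finset ι)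
    (P : ι → Finset W → Prop) [∀ i B, Decidable (P i B)] :
    ∑ B : Finset W, bernoulliWeight p B * #(T.filter fun i => P i B) =
      ∑ i ∈ T, randomSubsetProb p (P i) := by
  unfold randomSubsetProb
  rw [Finset.sum_comm]
  refine Finset.sum_congr rfl fun B _ => ?_
  rw [Finset.card_filter, Nat.cast_sum, Finset.mul_sum]
  refine Finset.sum_congr rfl fun i _ => ?_
  by_cases h : P i B <;> simp [h]

/-- A family of sets with pairwise intersections of size at most `L` has a large union. -/
lemma card_biUnion_ge_of_card_inter_le {ι W : Type*} [DecidableEq W] (Q : Finset ι)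
    (M : ι → Finset W) (N : ℕ) {L : ℝ} (hM : ∀ v ∈ Q, #(M v) = N)
    (hL : ∀ u ∈ Q, ∀ v ∈ Q, u ≠ v → (#(M u ∩ M v) : ℝ) ≤ L) (hL0 : 0 ≤ L) :
    #Q * (N - #Q * L) ≤ (#(Q.biUnion M) : ℝ) := by
  classical
  induction Q using Finset.induction_on with
  | empty => simp
  | insert a Q ha ih =>
    have ih' := ih (fun v hv => hM v (mem_insert_of_mem hv))
      (fun u hu v hv => hL u (mem_insert_of_mem hu) v (mem_insert_of_mem hv))
    rw [Finset.biUnion_insert, Finset.card_insert_of_notMem ha]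
    have h1 := Finset.card_union_add_card_inter (M a) (Q.biUnion M)
    have h2 : (#(M a ∩ Q.biUnion M) : ℝ) ≤ #Q * L := by
      rw [Finset.inter_biUnion]
      calc (#(Q.biUnion fun x => M a ∩ M x) : ℝ) ≤ ∑ x ∈ Q, (#(M a ∩ M x) : ℝ) := by
            exact_mod_cast Finset.card_biUnion_le
        _ ≤ ∑ x ∈ Q, L := Finset.sum_le_sum fun x hx =>
            hL a (mem_insert_self _ _) x (mem_insert_of_mem hx) (by rintro rfl; exact ha hx)
        _ = #Q * L := by simp
    rw [hM a (mem_insert_self _ _)] at h1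
    have h3 : (#(M a ∪ Q.biUnion M) : ℝ) + #(M a ∩ Q.biUnion M) = N + #(Q.biUnion M) := by
      exact_mod_cast h1
    push_cast
    nlinarith [mul_nonneg (Nat.cast_nonneg (α := ℝ) #Q) hL0]

/-- Upper tail bound, by the `q`-th factorial moment, for the number of sets of a family with
small pairwise intersections that a `p`-random set avoids. -/
lemma randomSubsetProb_card_disjoint_gt_le [DecidableEq W] (h0 : 0 ≤ p) (h1 : p ≤ 1) {ι : Type*} (C : Finset ι)
    (M : ι → Finset W) (N q : ℕ) {L m x : ℝ} (hM : ∀ v ∈ C, #(M v) = N)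
    (hL : ∀ u ∈ C, ∀ v ∈ C, u ≠ v → (#(M u ∩ M v) : ℝ) ≤ L) (hL0 : 0 ≤ L)
    (hm : (#C : ℝ) ≤ m) (hx : (q : ℝ) < x) :
    randomSubsetProb p (fun B => x < #(C.filter fun v => Disjoint B (M v))) ≤
      (m * Real.exp (-(p * (N - q * L))) / (x - q)) ^ q := by
  classical
  have hxq : 0 < (x - q) ^ q := pow_pos (by linarith) _
  have hmoment : ∑ B : Finset W, bernoulliWeight p B *
      ((#(C.filter fun v => Disjoint B (M v))).choose q : ℝ) ≤
      (#C).choose q * Real.exp (-(p * (N - q * L))) ^ q := by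
    have h2 : ∀ B : Finset W, (#(C.filter fun v => Disjoint B (M v))).choose q =
        #((C.powersetCard q).filter fun Q => Disjoint B (Q.biUnion M)) := by
      intro B
      rw [← Finset.card_powersetCard]
      congr 1
      ext Q
      simp only [mem_powersetCard, mem_filter, Finset.disjoint_biUnion_right, Finset.subset_iff]
      grind
    simp_rw [h2]
    rw [sum_bernoulliWeight_mul_card_filter p (C.powersetCard q)
      (fun Q B => Disjoint B (Q.biUnion M)), ← Finset.card_powersetCard, ← nsmul_eq_mul]
    refine Finset.sum_le_card_nsmul _ _ _ fun Q hQ => ?_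
    obtain ⟨hQC, hQq⟩ := mem_powersetCard.1 hQ
    rw [randomSubsetProb_disjoint, ← Real.exp_nat_mul]
    have hu := card_biUnion_ge_of_card_inter_le Q M N (fun v hv => hM v (hQC hv))
      (fun u hu v hv => hL u (hQC hu) v (hQC hv)) hL0
    rw [hQq] at hu
    calc (1 - p) ^ #(Q.biUnion M) ≤ Real.exp (-p) ^ #(Q.biUnion M) :=
          pow_le_pow_left₀ (by linarith) (by linarith [Real.add_one_le_exp (-p)]) _
      _ = Real.exp (#(Q.biUnion M) * -p) := (Real.exp_nat_mul _ _).symm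
      _ ≤ _ := Real.exp_le_exp.2 (by nlinarith)
  have hlow : randomSubsetProb p (fun B => x < #(C.filter fun v => Disjoint B (M v))) *
      ((x - q) ^ q / q.factorial) ≤ ∑ B : Finset W, bernoulliWeight p B *
      ((#(C.filter fun v => Disjoint B (M v))).choose q : ℝ) := by
    unfold randomSubsetProb
    rw [Finset.sum_mul]
    refine Finset.sum_le_sum fun B _ => ?_
    have hw := bernoulliWeight_nonneg h0 h1 B
    split_ifs with h
    · refine mul_le_mul_of_nonneg_left ?_ hw
      set X := #(C.filter fun v => Disjoint B (M v))
      have hqX : q < X := by exact_mod_cast hx.trans h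
      rw [div_le_iff₀ (by positivity)]
      have h3 : (X + 1 - q) ^ q ≤ X.descFactorial q := Nat.pow_sub_le_descFactorial X q
      rw [Nat.descFactorial_eq_factorial_mul_choose] at h3
      have h4 : ((X + 1 - q : ℕ) : ℝ) = X + 1 - q := by
        rw [Nat.cast_sub (by omega)]; push_cast; ring
      calc (x - q) ^ q ≤ (X + 1 - q : ℝ) ^ q := by gcongr; linarith
        _ ≤ q.factorial * X.choose q := by rw [← h4]; exact_mod_cast h3
        _ = _ := mul_comm _ _
    · rw [zero_mul]; positivity
  have hup : ((#C).choose q : ℝ) ≤ m ^ q / q.factorial :=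
    (Nat.choose_le_pow_div q (#C)).trans (by gcongr)
  have hE : 0 ≤ Real.exp (-(p * (N - q * L))) ^ q := by positivity
  have hall := (hlow.trans hmoment).trans (mul_le_mul_of_nonneg_right hup hE)
  rw [div_pow, mul_pow, le_div_iff₀ hxq]
  have hf : (0 : ℝ) < q.factorial := by positivity
  rw [mul_div_assoc', div_mul_eq_mul_div, div_le_div_iff_of_pos_right hf] at hall
  exact hall

end RandomSubset

section Nibble

variable {V : Type*}

open Finset

open Classical in
/-- The subgraph of `G` induced on `U` has maximum degree at most `d` and maximum codegree at
most `k`. -/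
def SimpleGraph.SparseOn (G : SimpleGraph V) (U : Finset V) (d k : ℝ) : Prop :=
  (∀ v ∈ U, (#(U.filter fun u => G.Adj v u) : ℝ) ≤ d) ∧
    ∀ u ∈ U, ∀ v ∈ U, u ≠ v → (#(U.filter fun w => G.Adj u w ∧ G.Adj v w) : ℝ) ≤ k

/-- Every induced subgraph of `G` with maximum degree at most `d` and maximum codegree at most `k`
has an independent set containing at least a proportion `f` of its vertices. -/
def SimpleGraph.HasIndepDensity (G : SimpleGraph V) (d k f : ℝ) : Prop :=
  ∀ U : Finset V, G.SparseOn U d k →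
    ∃ s ⊆ U, (∀ a ∈ s, ∀ b ∈ s, ¬ G.Adj a b) ∧ f * #U ≤ (#s : ℝ)

open Classical in
/-- The closed neighbourhoods in `U`, padded by private elements to a common size. -/
lemma SimpleGraph.SparseOn.exists_padded_nbhds {G : SimpleGraph V} {U : Finset V} {d k : ℝ}
    (h : G.SparseOn U d k) {N : ℕ} (hN : N = ⌊d⌋₊ + 1) :
    ∃ M : V → Finset (V ⊕ V × Fin N), ∀ v ∈ U, #(M v) = N ∧
      (∀ u, Sum.inl u ∈ M v ↔ u = v ∨ u ∈ U ∧ G.Adj v u) ∧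
      ∀ u ∈ U, u ≠ v → (#(M u ∩ M v) : ℝ) ≤ k + 2 := by
  classical
  refine ⟨fun v => (insert v (U.filter fun u => G.Adj v u)).disjSum
    ({v} ×ˢ univ.filter fun i : Fin N => i.1 < ⌊d⌋₊ - #(U.filter fun u => G.Adj v u)),
    fun v hv => ⟨?_, ?_, ?_⟩⟩
  · have h1 : #(U.filter fun u => G.Adj v u) ≤ ⌊d⌋₊ := by
      apply Nat.le_floor
      convert h.1 v hv
    rw [Finset.card_disjSum, Finset.card_insert_of_notMem (by simp), Finset.card_product,
      Finset.card_singleton, Fin.card_filter_val_lt]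
    omega
  · intro u
    simp
  · intro u hu huv
    have h1 := h.2 u hu v hv huv
    set T := U.filter fun w => G.Adj u w ∧ G.Adj v w with hT
    have h2 : #(({u, v} ∪ T : Finset V).map Function.Embedding.inl :
        Finset (V ⊕ V × Fin N)) ≤ 2 + #T := by
      rw [Finset.card_map]
      exact (Finset.card_union_le _ _).trans (by gcongr; exact Finset.card_le_two)
    refine (Nat.cast_le.2 ((Finset.card_le_card ?_).trans h2)).trans ?_
    · rintro (w | ⟨w, i⟩) hw
      · simp at hw ⊢
        grind
      · simp at hw
        grind
    · push_cast
      have : (#T : ℝ) ≤ k := by convert h1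
      linarith

/-- One step of the nibble. -/
lemma SimpleGraph.HasIndepDensity.nibble [Fintype V] {G : SimpleGraph V} {d k d' k' f f' p : ℝ}
    {q : ℕ} (h : G.HasIndepDensity d' k' f') (h0 : 0 ≤ p) (h1 : p ≤ 1) (hf' : 0 ≤ f')
    (hd : 0 ≤ d) (hk : 0 ≤ k) (hd' : q < d') (hk' : q < k')
    (hf : f ≤ p * (1 - p) ^ ⌊d⌋₊ + f' * ((1 - p) ^ (⌊d⌋₊ + 1) -
      ((d * Real.exp (-(p * (d - q * (k + 2)))) / (d' - q)) ^ q +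
        d ^ 2 * (k * Real.exp (-(p * (d - q * (k + 2)))) / (k' - q)) ^ q))) :
    G.HasIndepDensity d k f := by
  classical
  intro U hU
  obtain ⟨N, hN⟩ : ∃ N, N = ⌊d⌋₊ + 1 := ⟨_, rfl⟩
  obtain ⟨M, hM⟩ := hU.exists_padded_nbhds hN
  rw [← hN] at hf
  have hdN : d ≤ N := by rw [hN]; push_cast; exact (Nat.lt_floor_add_one d).le
  set nb : V → Finset V := fun v => U.filter fun u => G.Adj v u with hnb
  have hdeg : ∀ v ∈ U, (#(nb v) : ℝ) ≤ d := fun v hv => by convert hU.1 v hv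
  have hcodeg : ∀ u ∈ U, ∀ v ∈ U, u ≠ v → (#(nb u ∩ nb v) : ℝ) ≤ k := fun u hu v hv huv => by
    convert hU.2 u hu v hv huv using 3
    ext w
    simp [hnb]
    tauto
  let S : Finset (V ⊕ V × Fin N) → Finset V := fun B => U.filter fun v => Disjoint B (M v)
  let I : Finset (V ⊕ V × Fin N) → Finset V := fun B =>
    U.filter fun v => Sum.inl v ∈ B ∧ Disjoint B ((nb v).map Function.Embedding.inl)
  let bad : V → Finset (V ⊕ V × Fin N) → Prop := fun v B =>
    d' < #((nb v).filter fun w => Disjoint B (M w)) ∨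
      ∃ u ∈ ((nb v).biUnion nb).erase v,
        k' < #((nb u ∩ nb v).filter fun w => Disjoint B (M w))
  obtain ⟨s₀, hs₀, hmax⟩ := Finset.exists_max_image
    (U.powerset.filter fun s => ∀ a ∈ s, ∀ b ∈ s, ¬ G.Adj a b) (fun s => #s) ⟨∅, by simp⟩
  simp only [Finset.mem_filter, Finset.mem_powerset] at hs₀ hmax
  refine ⟨s₀, hs₀.1, hs₀.2, ?_⟩
  have hB : ∀ B, (#(I B) : ℝ) + f' * (#(S B) - #(U.filter fun v => bad v B)) ≤ #s₀ := by
    intro B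
    have hsp : G.SparseOn (S B \ U.filter fun v => bad v B) d' k' := by
      constructor
      · intro v hv
        simp only [S, Finset.mem_sdiff, Finset.mem_filter, not_and] at hv
        have hb := hv.2 hv.1.1
        simp only [bad, not_or, not_lt] at hb
        refine le_trans (Nat.cast_le.2 (Finset.card_le_card fun w hw => ?_)) hb.1
        simp [S, hnb] at hw ⊢
        tauto
      · intro u hu v hv huv
        simp only [S, Finset.mem_sdiff, Finset.mem_filter, not_and] at hu hv
        have hb := hv.2 hv.1.1
        simp only [bad, not_or, not_lt, not_exists, not_and] at hb
        by_contra! hlt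
        have hlt' : k' < #((nb u ∩ nb v).filter fun w => Disjoint B (M w)) := by
          refine hlt.trans_le (Nat.cast_le.2 (Finset.card_le_card fun w hw => ?_))
          simp [S, hnb] at hw ⊢
          tauto
        refine absurd (hb.2 u ?_) (not_le.2 hlt')
        have hpos : 0 < #((nb u ∩ nb v).filter fun w => Disjoint B (M w)) := by
          have : (0 : ℝ) ≤ q := by positivity
          exact_mod_cast (this.trans_lt hk').trans hlt'
        obtain ⟨w, hw⟩ := Finset.card_pos.1 hpos
        simp only [hnb, Finset.mem_filter, Finset.mem_inter, Finset.mem_erase,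
          Finset.mem_biUnion] at hw ⊢
        exact ⟨huv, w, hw.1.2, hu.1.1, hw.1.1.2.symm⟩
    obtain ⟨s, hsU, hsi, hs⟩ := h _ hsp
    have hsS : ∀ v ∈ s, v ∈ U ∧ Disjoint B (M v) := fun v hv =>
      Finset.mem_filter.1 (Finset.mem_sdiff.1 (hsU hv)).1
    have hsI : ∀ v ∈ s, ∀ u ∈ I B, u ≠ v ∧ ¬ G.Adj v u := by
      intro v hv u hu
      obtain ⟨huU, huB, -⟩ := Finset.mem_filter.1 hu
      obtain ⟨hvU, hvB⟩ := hsS v hv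
      have := mt ((hM v hvU).2.1 u).2 (Finset.disjoint_left.1 hvB huB)
      grind
    have hII : ∀ u ∈ I B, ∀ v ∈ I B, ¬ G.Adj u v := by
      intro u hu v hv huv
      obtain ⟨huU, huB, huD⟩ := Finset.mem_filter.1 hu
      obtain ⟨hvU, hvB, -⟩ := Finset.mem_filter.1 hv
      refine Finset.disjoint_left.1 huD hvB ?_
      simp [hnb, hvU, huv]
    have hle := hmax (I B ∪ s) ⟨Finset.union_subset (Finset.filter_subset _ _)
      (fun v hv => (hsS v hv).1), by
        intro a ha b hb hab
        rcases Finset.mem_union.1 ha with ha | ha <;> rcases Finset.mem_union.1 hb with hb | hb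
        · exact hII a ha b hb hab
        · exact (hsI b hb a ha).2 hab.symm
        · exact (hsI a ha b hb).2 hab
        · exact hsi a ha b hb hab⟩
    rw [Finset.card_union_of_disjoint
      (Finset.disjoint_left.2 fun v hv hvs => (hsI v hvs v hv).1 rfl)] at hle
    have h2 : (#(S B) : ℝ) - #(U.filter fun v => bad v B) ≤
        #(S B \ U.filter fun v => bad v B) := by
      have := Finset.le_card_sdiff (U.filter fun v => bad v B) (S B)
      rw [sub_le_iff_le_add]
      exact_mod_cast Nat.sub_le_iff_le_add.1 this
    calc (#(I B) : ℝ) + f' * (#(S B) - #(U.filter fun v => bad v B))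
        ≤ #(I B) + f' * #(S B \ U.filter fun v => bad v B) := by gcongr
      _ ≤ #(I B) + #s := by gcongr
      _ ≤ #s₀ := by exact_mod_cast hle
  have hexp : ∑ B, bernoulliWeight p B *
      ((#(I B) : ℝ) + f' * (#(S B) - #(U.filter fun v => bad v B))) ≤ #s₀ := by
    calc _ ≤ ∑ B, bernoulliWeight p B * (#s₀ : ℝ) := Finset.sum_le_sum fun B _ =>
          mul_le_mul_of_nonneg_left (hB B) (bernoulliWeight_nonneg h0 h1 B)
      _ = #s₀ := by rw [← Finset.sum_mul, sum_bernoulliWeight, one_mul]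
  have hsplit : ∑ B, bernoulliWeight p B *
      ((#(I B) : ℝ) + f' * (#(S B) - #(U.filter fun v => bad v B))) =
      ∑ B, bernoulliWeight p B * (#(I B) : ℝ) + f' * (∑ B, bernoulliWeight p B * (#(S B) : ℝ) -
        ∑ B, bernoulliWeight p B * (#(U.filter fun v => bad v B) : ℝ)) := by
    rw [← Finset.sum_sub_distrib, Finset.mul_sum, ← Finset.sum_add_distrib]
    exact Finset.sum_congr rfl fun B _ => by ring
  have hI : #U * (p * (1 - p) ^ ⌊d⌋₊) ≤ ∑ B, bernoulliWeight p B * (#(I B) : ℝ) := by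
    rw [sum_bernoulliWeight_mul_card_filter, ← nsmul_eq_mul]
    refine Finset.card_nsmul_le_sum _ _ _ fun v hv => ?_
    rw [randomSubsetProb_mem_and_disjoint p (by simp [hnb]), Finset.card_map]
    exact mul_le_mul_of_nonneg_left (pow_le_pow_of_le_one (by linarith) (by linarith)
      (Nat.le_floor (hdeg v hv))) h0
  have hS : ∑ B, bernoulliWeight p B * (#(S B) : ℝ) = #U * (1 - p) ^ N := by
    rw [sum_bernoulliWeight_mul_card_filter, ← nsmul_eq_mul]
    refine Finset.sum_eq_card_nsmul fun v hv => ?_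
    rw [randomSubsetProb_disjoint, (hM v hv).1]
  have hMcard : ∀ C ⊆ U, ∀ v ∈ C, #(M v) = N := fun C hC v hv => (hM v (hC hv)).1
  have hMinter : ∀ C ⊆ U, ∀ u ∈ C, ∀ v ∈ C, u ≠ v → (#(M u ∩ M v) : ℝ) ≤ k + 2 :=
    fun C hC u hu v hv huv => by convert (hM v (hC hv)).2.2 u (hC hu) huv
  have htail : ∀ C ⊆ U, ∀ m x : ℝ, (#C : ℝ) ≤ m → q < x →
      randomSubsetProb p (fun B => x < #(C.filter fun w => Disjoint B (M w))) ≤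
        (m * Real.exp (-(p * (d - q * (k + 2)))) / (x - q)) ^ q := by
    intro C hC m x hm hx
    have hm0 : 0 ≤ m := (Nat.cast_nonneg _).trans hm
    have hx0 : 0 ≤ x - q := by linarith
    refine le_trans (by
      convert randomSubsetProb_card_disjoint_gt_le h0 h1 C M N q (hMcard C hC) (hMinter C hC)
        (by linarith) hm hx) ?_
    gcongr
  have hbad : ∑ B, bernoulliWeight p B * (#(U.filter fun v => bad v B) : ℝ) ≤
      #U * ((d * Real.exp (-(p * (d - q * (k + 2)))) / (d' - q)) ^ q +
        d ^ 2 * (k * Real.exp (-(p * (d - q * (k + 2)))) / (k' - q)) ^ q) := by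
    rw [sum_bernoulliWeight_mul_card_filter, ← nsmul_eq_mul]
    refine Finset.sum_le_card_nsmul _ _ _ fun v hv => ?_
    refine (randomSubsetProb_or_le h0 h1 _ _).trans (add_le_add
      (htail _ (Finset.filter_subset _ _) _ _ (hdeg v hv) hd') ?_)
    refine (randomSubsetProb_exists_le h0 h1 _ _).trans ?_
    have hk0 : 0 ≤ k' - q := by linarith
    have hT : (#(((nb v).biUnion nb).erase v) : ℝ) ≤ d ^ 2 := by
      calc (#(((nb v).biUnion nb).erase v) : ℝ) ≤ #((nb v).biUnion nb) :=
            Nat.cast_le.2 (Finset.card_erase_le)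
        _ ≤ ∑ w ∈ nb v, (#(nb w) : ℝ) := by exact_mod_cast Finset.card_biUnion_le
        _ ≤ ∑ w ∈ nb v, d := Finset.sum_le_sum fun w hw => hdeg w (Finset.mem_filter.1 hw).1
        _ = #(nb v) * d := by simp
        _ ≤ d ^ 2 := by rw [sq]; gcongr; exact hdeg v hv
    calc _ ≤ #(((nb v).biUnion nb).erase v) •
          (k * Real.exp (-(p * (d - q * (k + 2)))) / (k' - q)) ^ q := by
          refine Finset.sum_le_card_nsmul _ _ _ fun u hu => ?_
          obtain ⟨huv, hu⟩ := Finset.mem_erase.1 hu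
          obtain ⟨w, -, hu⟩ := Finset.mem_biUnion.1 hu
          exact htail _ (Finset.inter_subset_left.trans (Finset.filter_subset _ _)) _ _
            (hcodeg u (Finset.mem_filter.1 hu).1 v hv huv) hk'
      _ ≤ _ := by
          rw [nsmul_eq_mul]
          gcongr
  rw [hsplit] at hexp
  set b := (d * Real.exp (-(p * (d - q * (k + 2)))) / (d' - q)) ^ q +
        d ^ 2 * (k * Real.exp (-(p * (d - q * (k + 2)))) / (k' - q)) ^ q
  calc f * #U ≤ (p * (1 - p) ^ ⌊d⌋₊ + f' * ((1 - p) ^ N - b)) * #U := by gcongr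
    _ = #U * (p * (1 - p) ^ ⌊d⌋₊) + f' * (#U * (1 - p) ^ N - #U * b) := by ring
    _ ≤ _ := by gcongr; exact hS.ge
    _ ≤ _ := hexp

/-- `1 - x ≥ exp (-x - x ^ 2)` on `[0, 1/2]`. -/
lemma Real.exp_neg_sub_sq_le_one_sub {x : ℝ} (h0 : 0 ≤ x) (h1 : x ≤ 1 / 2) :
    Real.exp (-x - x ^ 2) ≤ 1 - x := by
  have h2 := Real.quadratic_le_exp_of_nonneg (by positivity : 0 ≤ x + x ^ 2)
  rw [show -x - x ^ 2 = -(x + x ^ 2) by ring, Real.exp_neg]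
  refine inv_le_of_inv_le₀ (by linarith) (le_trans ?_ h2)
  rw [inv_le_iff_one_le_mul₀ (by linarith)]
  have h3 : 0 ≤ x ^ 2 * ((1 - 2 * x) * (1 + x)) :=
    mul_nonneg (by positivity) (mul_nonneg (by linarith) (by linarith))
  have h4 : 0 ≤ x ^ 4 * (1 - x) := mul_nonneg (by positivity) (by linarith)
  nlinarith

/-- A nibble step selecting vertices with probability `γ / d`, with relative error `η`. -/
lemma SimpleGraph.HasIndepDensity.nibble_exp [Fintype V] {G : SimpleGraph V}
    {γ η κ d f f' : ℝ} {q : ℕ}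
    (h : G.HasIndepDensity (Real.exp (-γ + η) * d) (κ * (Real.exp (-γ + η) * d)) f')
    (hγ : 0 < γ) (hγ' : γ ≤ 1 / 12) (hη : 0 < η) (hηγ : η ≤ γ) (hκ : 0 < κ) (hκ' : κ ≤ 1)
    (hq : 1 ≤ q) (hd : 0 < d) (hcod : γ * q * (κ + 2 / d) ≤ η / 4) (hlarge : q / (κ * d) ≤ η / 4)
    (hfail : (1 + d ^ 2) * Real.exp (-(η / 4)) ^ q ≤ η / 8) (hf' : 0 ≤ f')
    (hf : f ≤ γ / d * (1 - 2 * γ) + Real.exp (-γ - η) * f') :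
    G.HasIndepDensity d (κ * d) f := by
  have hκd : 0 < κ * d := by positivity
  have hq1 : (1 : ℝ) ≤ q := by exact_mod_cast hq
  have hqd : q / d ≤ η / 4 := by
    refine le_trans ?_ hlarge
    gcongr
    nlinarith
  have hd1 : 1 / d ≤ η / 4 := le_trans (by gcongr) hqd
  have hexpγ : (1 / 2 : ℝ) ≤ Real.exp (-γ) := by linarith [Real.add_one_le_exp (-γ)]
  -- the room left in the degree and codegree bounds
  have hroom : Real.exp (-γ + η / 2) ≤ Real.exp (-γ + η) - η / 4 := by
    have h1 : Real.exp (-γ + η) = Real.exp (-γ + η / 2) * Real.exp (η / 2) := by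
      rw [← Real.exp_add]; ring_nf
    have h2 := Real.add_one_le_exp (η / 2)
    have h3 : (1 / 2 : ℝ) ≤ Real.exp (-γ + η / 2) :=
      hexpγ.trans (Real.exp_le_exp.2 (by linarith))
    rw [h1]
    nlinarith
  have hdq : Real.exp (-γ + η / 2) * d ≤ Real.exp (-γ + η) * d - q := by
    rw [div_le_iff₀ hd] at hqd
    nlinarith
  have hkq : Real.exp (-γ + η / 2) * (κ * d) ≤ κ * (Real.exp (-γ + η) * d) - q := by
    rw [div_le_iff₀ hκd] at hlarge
    nlinarith
  have hpos := Real.exp_pos (-γ + η / 2)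
  have hE : Real.exp (-(γ / d * (d - q * (κ * d + 2)))) ≤ Real.exp (-γ + η / 4) := by
    apply Real.exp_le_exp.2
    have : -(γ / d * (d - q * (κ * d + 2))) = -γ + γ * q * (κ + 2 / d) := by
      field_simp
      ring
    linarith
  have hratio : ∀ m x : ℝ, 0 < m → Real.exp (-γ + η / 2) * m ≤ x →
      m * Real.exp (-(γ / d * (d - q * (κ * d + 2)))) / x ≤ Real.exp (-(η / 4)) := by
    intro m x hm hx
    have hx0 : 0 < x := lt_of_lt_of_le (by positivity) hx
    rw [div_le_iff₀ hx0]
    calc m * Real.exp (-(γ / d * (d - q * (κ * d + 2)))) ≤ m * Real.exp (-γ + η / 4) := by gcongr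
      _ = Real.exp (-(η / 4)) * (Real.exp (-γ + η / 2) * m) := by
        rw [← mul_assoc, ← Real.exp_add, mul_comm]; ring_nf
      _ ≤ _ := by gcongr
  have hp : γ / d ≤ 1 / 2 := by
    rw [div_eq_mul_one_div]
    nlinarith
  have hp0 : 0 ≤ γ / d := by positivity
  have hsurv : Real.exp (-γ - η / 2) ≤ (1 - γ / d) ^ (⌊d⌋₊ + 1) := by
    calc Real.exp (-γ - η / 2) ≤ Real.exp ((⌊d⌋₊ + 1 : ℕ) * (-(γ / d) - (γ / d) ^ 2)) := by
          apply Real.exp_le_exp.2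
          have h1 : ((⌊d⌋₊ + 1 : ℕ) : ℝ) ≤ d + 1 := by
            push_cast
            linarith [Nat.floor_le hd.le]
          have h2 : (d + 1) * (γ / d + (γ / d) ^ 2) =
              γ + (γ * (1 / d)) + γ * (γ * (1 / d)) * (1 + 1 / d) := by
            field_simp
          have h3 : ((⌊d⌋₊ + 1 : ℕ) : ℝ) * (γ / d + (γ / d) ^ 2) ≤
              (d + 1) * (γ / d + (γ / d) ^ 2) := by gcongr
          have h4 : γ * (1 / d) ≤ η / 48 := by
            nlinarith [one_div_pos.2 hd]
          have h5 : γ * (γ * (1 / d)) * (1 + 1 / d) ≤ 1 * (η / 48) * (1 + 1) := by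
            gcongr
            · linarith
            · linarith
          linarith
      _ = Real.exp (-(γ / d) - (γ / d) ^ 2) ^ (⌊d⌋₊ + 1) := Real.exp_nat_mul _ _
      _ ≤ _ := by
        gcongr
        exact Real.exp_neg_sub_sq_le_one_sub hp0 hp
  have hsurv' : 1 - 2 * γ ≤ (1 - γ / d) ^ ⌊d⌋₊ := by
    have h1 : (1 - γ / d) ^ (⌊d⌋₊ + 1) ≤ (1 - γ / d) ^ ⌊d⌋₊ :=
      pow_le_pow_of_le_one (by linarith) (by linarith) (Nat.le_succ _)
    linarith [Real.add_one_le_exp (-γ - η / 2)]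
  have hgap : Real.exp (-γ - η) + η / 8 ≤ Real.exp (-γ - η / 2) := by
    have h1 : Real.exp (-γ - η / 2) = Real.exp (-γ - η) * Real.exp (η / 2) := by
      rw [← Real.exp_add]; ring_nf
    have h2 := Real.add_one_le_exp (η / 2)
    have h3 : (1 / 2 : ℝ) ≤ Real.exp (-γ - η) := by
      linarith [Real.add_one_le_exp (-γ - η)]
    rw [h1]
    nlinarith
  refine h.nibble (p := γ / d) (q := q) hp0 (by linarith) hf' hd.le hκd.le
    (sub_pos.1 (lt_of_lt_of_le (by positivity) hdq))
    (sub_pos.1 (lt_of_lt_of_le (by positivity) hkq)) ?_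
  have hbad : (d * Real.exp (-(γ / d * (d - q * (κ * d + 2)))) /
        (Real.exp (-γ + η) * d - q)) ^ q +
      d ^ 2 * (κ * d * Real.exp (-(γ / d * (d - q * (κ * d + 2)))) /
        (κ * (Real.exp (-γ + η) * d) - q)) ^ q ≤ η / 8 := by
    refine le_trans ?_ hfail
    rw [add_mul, one_mul]
    have h1 := (mul_pos hpos hd).le.trans hdq
    have h2 := (mul_pos hpos hκd).le.trans hkq
    gcongr
    · exact hratio d _ hd hdq
    · exact hratio (κ * d) _ hκd hkq
  refine hf.trans (add_le_add (by gcongr) ?_)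
  rw [mul_comm]
  gcongr
  linarith

/-- Iterating the nibble `j` times. -/
lemma SimpleGraph.hasIndepDensity_iterate [Fintype V] (G : SimpleGraph V)
    {γ η κ d₀ D : ℝ} {q : ℕ}
    (hγ : 0 < γ) (hγ' : γ ≤ 1 / 12) (hη : 0 < η) (hηγ : η ≤ γ) (hκ : 0 < κ) (hκ' : κ ≤ 1)
    (hq : 1 ≤ q) (hd₀ : 0 < d₀) (hcod : γ * q * (κ + 2 / d₀) ≤ η / 4)
    (hlarge : q / (κ * d₀) ≤ η / 4) (hfail : (1 + D ^ 2) * Real.exp (-(η / 4)) ^ q ≤ η / 8)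
    (j : ℕ) (d : ℝ) (hd : d₀ * Real.exp (γ * j) ≤ d) (hdD : d ≤ D) :
    G.HasIndepDensity d (κ * d) (γ * (1 - 2 * γ) * j * Real.exp (-(2 * η * j)) / d) := by
  induction j generalizing d with
  | zero => exact fun U _ => ⟨∅, by simp⟩
  | succ j ih =>
    have hdd₀ : d₀ ≤ d := le_trans (le_mul_of_one_le_right hd₀.le
      (Real.one_le_exp (by positivity))) hd
    have hd0 : 0 < d := hd₀.trans_le hdd₀
    have h2γ : 0 ≤ 1 - 2 * γ := by linarith
    refine (ih (Real.exp (-γ + η) * d) ?_ ?_).nibble_exp hγ hγ' hη hηγ hκ hκ' hq hd0 ?_ ?_ ?_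
      (by positivity) ?_
    · calc d₀ * Real.exp (γ * j) = Real.exp (-γ) * (d₀ * Real.exp (γ * (j + 1 : ℕ))) := by
            rw [mul_left_comm, ← Real.exp_add]; push_cast; ring_nf
        _ ≤ Real.exp (-γ + η) * d := by gcongr; linarith
    · exact (mul_le_of_le_one_left hd0.le (Real.exp_le_one_iff.2 (by linarith))).trans hdD
    · exact le_trans (by gcongr) hcod
    · exact le_trans (by gcongr) hlarge
    · exact le_trans (by gcongr) hfail
    · have h1 : Real.exp (-(2 * η * (j + 1 : ℕ))) ≤ 1 := Real.exp_le_one_iff.2 (by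
        rw [neg_nonpos]; positivity)
      have h2 : Real.exp (-γ - η) *
          (γ * (1 - 2 * γ) * j * Real.exp (-(2 * η * j)) / (Real.exp (-γ + η) * d)) =
          γ * (1 - 2 * γ) * j * Real.exp (-(2 * η * (j + 1 : ℕ))) / d := by
        have : Real.exp (-γ - η) * Real.exp (-(2 * η * j)) =
            Real.exp (-(2 * η * (j + 1 : ℕ))) * Real.exp (-γ + η) := by
          rw [← Real.exp_add, ← Real.exp_add]; push_cast; ring_nf
        rw [mul_div_assoc', div_eq_div_iff (by positivity) (by positivity)]
        linear_combination γ * (1 - 2 * γ) * j * d * this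
      rw [h2, div_mul_eq_mul_div, ← add_div]
      gcongr
      have : γ * (1 - 2 * γ) * Real.exp (-(2 * η * (j + 1 : ℕ))) ≤ γ * (1 - 2 * γ) * 1 := by
        gcongr
      push_cast at this ⊢
      linarith

end Nibble

set_option maxHeartbeats 400000 in
/-- The nibble run until the degree is `Δ ^ γ`, where `Λ = log Δ`. -/
lemma SimpleGraph.hasIndepDensity_of_exp_large {V : Type*} [Fintype V] (G : SimpleGraph V)
    {γ Λ : ℝ} (hγ : 0 < γ) (hγ' : γ ≤ 1 / 12) (hΛ : 8 / γ ^ 2 ≤ Λ)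
    (hexp : 8704 * Λ ^ 10 / γ ^ 4 ≤ Real.exp (γ * Λ)) :
    G.HasIndepDensity (Real.exp Λ) (1 / (128 * Λ ^ 7) * Real.exp Λ)
      ((1 - 6 * γ) * Λ / Real.exp Λ) := by
  have hΛγ : 8 ≤ Λ * γ ^ 2 := by rwa [div_le_iff₀ (by positivity)] at hΛ
  have hΛ8 : 8 ≤ Λ := by
    have : 0 < Λ := lt_of_lt_of_le (by positivity) hΛ
    nlinarith [pow_le_one₀ (n := 2) hγ.le (by linarith : γ ≤ 1)]
  have hΛ0 : 0 < Λ := by linarith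
  obtain ⟨q, hqdef⟩ : ∃ q, q = ⌈16 * Λ ^ 2 / γ ^ 2⌉₊ := ⟨_, rfl⟩
  obtain ⟨η, hηdef⟩ : ∃ η, η = γ ^ 2 / Λ := ⟨_, rfl⟩
  have hη : 0 < η := by rw [hηdef]; positivity
  have hηγ : η ≤ γ := by
    rw [hηdef, div_le_iff₀ hΛ0]
    nlinarith
  have hql : 16 * Λ ^ 2 / γ ^ 2 ≤ q := hqdef ▸ Nat.le_ceil _
  have hqu : q ≤ 17 * Λ ^ 2 / γ ^ 2 := by
    rw [hqdef]
    have h1 := (Nat.ceil_lt_add_one (a := 16 * Λ ^ 2 / γ ^ 2) (by positivity)).le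
    have h2 : 1 ≤ Λ ^ 2 / γ ^ 2 := by
      rw [le_div_iff₀ (by positivity)]
      nlinarith
    calc _ ≤ 16 * Λ ^ 2 / γ ^ 2 + 1 := h1
      _ ≤ 16 * Λ ^ 2 / γ ^ 2 + Λ ^ 2 / γ ^ 2 := by gcongr
      _ = _ := by ring
  have hq : 1 ≤ q := hqdef ▸ Nat.one_le_ceil_iff.2 (by positivity)
  have hκ : 0 < 1 / (128 * Λ ^ 7) := by positivity
  have hκ' : 1 / (128 * Λ ^ 7) ≤ 1 := by
    rw [div_le_one (by positivity)]
    have : 1 ≤ Λ ^ 7 := one_le_pow₀ (by linarith)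
    linarith
  have hexp' : 8704 * Λ ^ 10 ≤ γ ^ 4 * Real.exp (γ * Λ) := by
    rwa [div_le_iff₀ (by positivity), mul_comm (Real.exp _)] at hexp
  have hE := Real.exp_pos (γ * Λ)
  have hcod : γ * q * (1 / (128 * Λ ^ 7) + 2 / Real.exp (γ * Λ)) ≤ η / 4 := by
    have h1 : γ * (17 * Λ ^ 2 / γ ^ 2) * (1 / (128 * Λ ^ 7)) ≤ η / 8 := by
      have h3 : γ * (17 * Λ ^ 2 / γ ^ 2) * (1 / (128 * Λ ^ 7)) = 17 / (128 * γ * Λ ^ 5) := by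
        field_simp
      rw [h3, hηdef, div_div, div_le_div_iff₀ (by positivity) (by positivity)]
      have h4 : 8 * 8 * (8 * Λ) ≤ Λ * γ ^ 2 * (Λ * γ ^ 2) * (Λ * Λ) := by gcongr
      have h5 : γ ^ 2 * (γ ^ 2 * Λ ^ 4) ≤ γ ^ 2 * (γ * Λ ^ 4) := by
        gcongr
        exact pow_le_of_le_one hγ.le (by linarith) two_ne_zero
      nlinarith
    have h2 : γ * (17 * Λ ^ 2 / γ ^ 2) * (2 / Real.exp (γ * Λ)) ≤ η / 8 := by
      have h3 : γ * (17 * Λ ^ 2 / γ ^ 2) * (2 / Real.exp (γ * Λ)) =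
          34 * Λ ^ 2 / (γ * Real.exp (γ * Λ)) := by
        field_simp
        ring
      rw [h3, hηdef, div_div, div_le_div_iff₀ (by positivity) (by positivity)]
      have h4 : γ ^ 4 * Real.exp (γ * Λ) ≤ γ ^ 3 * Real.exp (γ * Λ) := by
        gcongr ?_ * _
        exact pow_le_pow_of_le_one hγ.le (by linarith) (by norm_num)
      have h5 : Λ ^ 3 ≤ Λ ^ 10 := pow_le_pow_right₀ (by linarith) (by norm_num)
      nlinarith
    calc _ ≤ γ * (17 * Λ ^ 2 / γ ^ 2) * (1 / (128 * Λ ^ 7) + 2 / Real.exp (γ * Λ)) := by gcongr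
      _ ≤ _ := by rw [mul_add]; linarith
  have hlarge : q / (1 / (128 * Λ ^ 7) * Real.exp (γ * Λ)) ≤ η / 4 := by
    calc _ ≤ 17 * Λ ^ 2 / γ ^ 2 / (1 / (128 * Λ ^ 7) * Real.exp (γ * Λ)) := by gcongr
      _ = 2176 * Λ ^ 9 / (γ ^ 2 * Real.exp (γ * Λ)) := by field_simp; ring
      _ ≤ _ := by
        rw [hηdef, div_div, div_le_div_iff₀ (by positivity) (by positivity)]
        linarith
  have hfail : (1 + Real.exp Λ ^ 2) * Real.exp (-(η / 4)) ^ q ≤ η / 8 := by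
    have h1 : Real.exp (-(η / 4)) ^ q ≤ Real.exp (-(4 * Λ)) := by
      rw [← Real.exp_nat_mul]
      apply Real.exp_le_exp.2
      have : 16 * Λ ^ 2 / γ ^ 2 * (η / 4) ≤ q * (η / 4) := by gcongr
      have h3 : 16 * Λ ^ 2 / γ ^ 2 * (η / 4) = 4 * Λ := by rw [hηdef]; field_simp; ring
      linarith
    have h2 : Real.exp Λ ^ 2 = Real.exp (2 * Λ) := by rw [← Real.exp_nat_mul]; norm_num
    have h3 : Real.exp (2 * Λ) * Real.exp (-(4 * Λ)) = Real.exp (-(2 * Λ)) := by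
      rw [← Real.exp_add]; ring_nf
    have h4 : Real.exp (-(4 * Λ)) ≤ Real.exp (-(2 * Λ)) := Real.exp_le_exp.2 (by linarith)
    have h5 : Real.exp (-(2 * Λ)) ≤ 1 / (2 * Λ ^ 2) := by
      rw [Real.exp_neg, ← one_div]
      gcongr
      nlinarith [Real.quadratic_le_exp_of_nonneg (by linarith : 0 ≤ 2 * Λ)]
    calc _ ≤ (1 + Real.exp Λ ^ 2) * Real.exp (-(4 * Λ)) := by gcongr
      _ = Real.exp (-(4 * Λ)) + Real.exp (-(2 * Λ)) := by rw [h2, add_mul, h3, one_mul]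
      _ ≤ 1 / (2 * Λ ^ 2) + 1 / (2 * Λ ^ 2) := by linarith
      _ = 1 / Λ ^ 2 := by field_simp; norm_num
      _ ≤ η / 8 := by
        rw [hηdef, div_div, div_le_div_iff₀ (by positivity) (by positivity)]
        nlinarith
  obtain ⟨j, hj⟩ : ∃ j, j = ⌊(1 - γ) * Λ / γ⌋₊ := ⟨_, rfl⟩
  have hju : j * γ ≤ (1 - γ) * Λ := by
    rw [← le_div_iff₀ hγ, hj]
    exact Nat.floor_le (div_nonneg (mul_nonneg (by linarith) hΛ0.le) hγ.le)
  have hjl : (1 - 2 * γ) * Λ ≤ j * γ := by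
    have h1 := (Nat.lt_floor_add_one ((1 - γ) * Λ / γ)).le
    rw [div_le_iff₀ hγ, ← hj] at h1
    nlinarith
  have hmain := G.hasIndepDensity_iterate hγ hγ' hη hηγ hκ hκ' hq hE hcod hlarge hfail j
    (Real.exp Λ) (by rw [← Real.exp_add]; exact Real.exp_le_exp.2 (by linarith)) le_rfl
  intro U hU
  obtain ⟨s, hsU, hsi, hs⟩ := hmain U hU
  refine ⟨s, hsU, hsi, le_trans (mul_le_mul_of_nonneg_right
    (div_le_div_of_nonneg_right ?_ (Real.exp_pos Λ).le) (Nat.cast_nonneg _)) hs⟩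
  have hdecay : 1 - 2 * γ ≤ Real.exp (-(2 * η * j)) := by
    have h1 : η * j ≤ γ := by
      have h2 : η * Λ = γ ^ 2 := by rw [hηdef]; field_simp
      have h3 : η * (j * γ) ≤ η * Λ := by gcongr; nlinarith
      nlinarith
    linarith [Real.add_one_le_exp (-(2 * η * j))]
  have h2γ : 0 ≤ 1 - 2 * γ := by linarith
  calc (1 - 6 * γ) * Λ ≤ (1 - 2 * γ) * ((1 - 2 * γ) * Λ) * (1 - 2 * γ) := by
        have : (1 - 6 * γ) ≤ (1 - 2 * γ) ^ 3 := by nlinarith [sq_nonneg γ]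
        nlinarith
    _ ≤ (1 - 2 * γ) * (j * γ) * Real.exp (-(2 * η * j)) := by gcongr
    _ = _ := by ring

theorem independent_set_from_codegree :
    ∀ ε : ℝ, ε ∈ Set.Ioo 0 (1/2) → ∃ Δ₀ : ℕ, ∀ Δ : ℕ, Δ₀ ≤ Δ →
      ∀ (V : Type) [Fintype V] (G : SimpleGraph V),
        (∀ v : V, Nat.card {u : V | G.Adj v u} ≤ Δ) →
        (∀ u v : V, u ≠ v →
          (Nat.card {w : V | G.Adj u w ∧ G.Adj v w} : ℝ) ≤
            2^(-7 : ℤ) * Δ * (Real.log Δ)^(-7 : ℤ)) →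
        ∃ s : Finset V, (∀ a ∈ s, ∀ b ∈ s, ¬ G.Adj a b) ∧
          (1 - ε) * (Fintype.card V) * Real.log Δ / Δ ≤ s.card := by
  classical
  rintro ε ⟨hε0, hε1⟩
  have hγ : 0 < ε / 6 := by positivity
  have hlim := (isLittleO_pow_exp_pos_mul_atTop 10 hγ).bound
    (show 0 < (ε / 6) ^ 4 / 8704 by positivity)
  have hlog := Real.tendsto_log_atTop.comp (tendsto_natCast_atTop_atTop (R := ℝ))
  obtain ⟨Δ₀, hΔ₀⟩ := Filter.eventually_atTop.1 ((hlog.eventually hlim).and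
    ((hlog.eventually_ge_atTop (8 / (ε / 6) ^ 2)).and (Filter.eventually_ge_atTop 1)))
  refine ⟨Δ₀, fun Δ hΔ V _ G hdeg hcodeg => ?_⟩
  obtain ⟨h1, h2, h3⟩ := hΔ₀ Δ hΔ
  simp only [Function.comp_apply] at h1 h2
  have hΔ0 : (0 : ℝ) < Δ := by exact_mod_cast h3
  have hexp : Real.exp (Real.log Δ) = Δ := Real.exp_log hΔ0
  have hlog0 : 0 < Real.log Δ := lt_of_lt_of_le (by positivity) h2
  rw [Real.norm_of_nonneg (by positivity), Real.norm_of_nonneg (by positivity)] at h1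
  have hG := G.hasIndepDensity_of_exp_large hγ (by linarith) h2 (by
    rw [div_le_iff₀ (by positivity)]
    linarith)
  rw [hexp] at hG
  have hsparse : G.SparseOn Finset.univ Δ (1 / (128 * Real.log Δ ^ 7) * Δ) := by
    refine ⟨fun v _ => ?_, fun u _ v _ huv => ?_⟩
    · have := hdeg v
      rw [Nat.card_eq_fintype_card, Fintype.card_subtype] at this
      exact_mod_cast this
    · have := hcodeg u v huv
      rw [Nat.card_eq_fintype_card, Fintype.card_subtype] at this
      refine this.trans (le_of_eq ?_)
      rw [zpow_neg, zpow_neg]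
      norm_cast
      field_simp
      norm_num
  obtain ⟨s, -, hs, hcard⟩ := hG Finset.univ hsparse
  refine ⟨s, hs, le_trans (le_of_eq ?_) hcard⟩
  rw [Finset.card_univ]
  ring
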